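/- (Peterson–Woodward lemma) Let Φ be a reduced crystallographic root system in a finite-dimensional real vector space, with coroots α^∨ and canonical pairing ⟨·,·⟩ between roots and coweights, let Δ be a base (system of simple roots) of Φ, and let S ⊆ Δ. Let Q^∨ be the ℤ-span of all coroots and Q^∨_S the ℤ-span of {α^∨ : α ∈ S}, and let Φ_S⁺ denote the set of positive roots of Φ lying in the ℤ-span of S. Then every coset of Q^∨_S in Q^∨ contains a unique element h_PW such that ⟨α, h_PW⟩ ∈ {0, −1} for every α ∈ Φ_S⁺. -/

import Mathlib

lemma pw_closure {M : Type*} [AddCommGroup M] {r : ℕ} (f : Fin r → M) (S : Set (Fin r)) (x : M) :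
    x ∈ AddSubgroup.closure (f '' S) ↔
      ∃ c : Fin r → ℤ, (∀ i, i ∉ S → c i = 0) ∧ x = ∑ i, c i • f i := by
  classical
  constructor
  · intro hx
    induction hx using AddSubgroup.closure_induction with
    | mem x hx =>
      obtain ⟨i, hi, rfl⟩ := hx
      refine ⟨Pi.single i 1, ?_, ?_⟩
      · intro j hj
        have : j ≠ i := fun h => hj (h ▸ hi)
        simp [this]
      · rw [Finset.sum_eq_single i]
        · simp
        · intro j _ hj; simp [hj]
        · simp
    | zero => exact ⟨0, by simp, by simp⟩
    | add x y _ _ hx hy =>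
      obtain ⟨c, hc, rfl⟩ := hx
      obtain ⟨d, hd, rfl⟩ := hy
      refine ⟨c + d, ?_, ?_⟩
      · intro i hi; simp [hc i hi, hd i hi]
      · simp [add_smul, Finset.sum_add_distrib]
    | neg x _ hx =>
      obtain ⟨c, hc, rfl⟩ := hx
      exact ⟨-c, fun i hi => by simp [hc i hi], by simp⟩
  · rintro ⟨c, hc, rfl⟩
    refine AddSubgroup.sum_mem _ fun i _ => ?_
    by_cases hi : i ∈ S
    · exact AddSubgroup.zsmul_mem _ (AddSubgroup.subset_closure (Set.mem_image_of_mem f hi)) _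
    · rw [hc i hi]; simp

lemma pw_sum_sub {M : Type*} [AddCommGroup M] [Module ℝ M] {r : ℕ} (a b : Fin r → ℝ)
    (f : Fin r → M) : ∑ i, (a i - b i) • f i = ∑ i, a i • f i - ∑ i, b i • f i := by
  simp only [sub_smul, Finset.sum_sub_distrib]

lemma pw_sum_single {M : Type*} [AddCommGroup M] [Module ℝ M] {r : ℕ} (c : Fin r → ℤ) (i : Fin r)
    (e : ℤ) (f : Fin r → M) :
    ∑ j, (((c - Pi.single i e : Fin r → ℤ) j : ℤ) : ℝ) • f j = ∑ j, (c j : ℝ) • f j - (e : ℝ) • f i := by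
  simp only [Pi.sub_apply, Int.cast_sub, sub_smul, Finset.sum_sub_distrib]
  congr 1
  rw [Finset.sum_eq_single i]
  · simp
  · intro j _ hj; simp [hj]
  · simp

lemma pw_cast {M : Type*} [AddCommGroup M] [Module ℝ M] (n : ℤ) (x : M) : (n : ℝ) • x = n • x :=
  Int.cast_smul_eq_zsmul ℝ n x

section
variable {V : Type*} [AddCommGroup V] [Module ℝ V]

lemma pw_refl_sum (P : Finset V) (f : Module.Dual ℝ V) (a : V) (hfa : f a = 2)
    (hP : ∀ β ∈ P, β - f β • a ∈ P) (F : V → ℝ) :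
    ∑ β ∈ P, F (β - f β • a) = ∑ β ∈ P, F β := by
  have inv : ∀ β : V, (β - f β • a) - f (β - f β • a) • a = β := by
    intro β
    simp only [map_sub, map_smul, smul_eq_mul, hfa]
    module
  refine Finset.sum_nbij' (fun β => β - f β • a) (fun β => β - f β • a) hP hP ?_ ?_ ?_
  · intro β _; exact inv β
  · intro β _; exact inv β
  · intro β _; rfl

lemma pw_key (P : Finset V) (f : Module.Dual ℝ V) (a : V) (hfa : f a = 2)
    (hP : ∀ β ∈ P, β - f β • a ∈ P) (h : Module.Dual ℝ V) :
    2 * ∑ β ∈ P, h β * f β = h a * ∑ β ∈ P, f β ^ 2 := by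
  have e := pw_refl_sum P f a hfa hP (fun β => h β * f β)
  have : ∑ β ∈ P, h (β - f β • a) * f (β - f β • a)
      = h a * ∑ β ∈ P, f β ^ 2 - ∑ β ∈ P, h β * f β := by
    rw [Finset.mul_sum, ← Finset.sum_sub_distrib]
    refine Finset.sum_congr rfl fun β _ => ?_
    simp only [map_sub, map_smul, smul_eq_mul, hfa]
    ring
  linarith

lemma pw_form {r : ℕ} (P : Finset V) (S : Set (Fin r)) (Δ : Fin r → V)
    (cr : Fin r → Module.Dual ℝ V) (h2 : ∀ i, cr i (Δ i) = 2)
    (hP : ∀ i ∈ S, ∀ β ∈ P, β - cr i β • Δ i ∈ P)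
    (c : Fin r → ℝ) (hc : ∀ i, i ∉ S → c i = 0) (h : Module.Dual ℝ V) :
    ∑ β ∈ P, h β * (∑ i, c i • cr i) β
      = ∑ i, (c i * ((∑ β ∈ P, cr i β ^ 2) / 2)) * h (Δ i) := by
  have : ∀ β ∈ P, h β * (∑ i, c i • cr i) β = ∑ i, c i * (h β * cr i β) := by
    intro β _
    rw [LinearMap.sum_apply, Finset.mul_sum]
    refine Finset.sum_congr rfl fun i _ => ?_
    simp; ring
  rw [Finset.sum_congr rfl this, Finset.sum_comm]
  refine Finset.sum_congr rfl fun i _ => ?_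
  by_cases hi : i ∈ S
  · have := pw_key P (cr i) (Δ i) (h2 i) (hP i hi) h
    rw [← Finset.mul_sum]
    linear_combination (c i / 2) * this
  · simp [hc i hi]

lemma pw_norm_pos {r : ℕ} (P : Finset V) (S : Set (Fin r)) (Δ : Fin r → V)
    (cr : Fin r → Module.Dual ℝ V) (h2 : ∀ i, cr i (Δ i) = 2)
    (hΔP : ∀ i ∈ S, Δ i ∈ P) (i : Fin r) (hi : i ∈ S) : 0 < ∑ β ∈ P, cr i β ^ 2 := by
  have := Finset.single_le_sum (f := fun β => cr i β ^ 2) (fun β _ => sq_nonneg _) (hΔP i hi)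
  simp only [h2] at this
  linarith

/-- a combination of simple coroots vanishing on `P` has zero coefficients -/
lemma pw_zero {r : ℕ} (P : Finset V) (S : Set (Fin r)) (Δ : Fin r → V)
    (hind : LinearIndependent ℝ Δ)
    (cr : Fin r → Module.Dual ℝ V) (h2 : ∀ i, cr i (Δ i) = 2)
    (hΔP : ∀ i ∈ S, Δ i ∈ P)
    (hP : ∀ i ∈ S, ∀ β ∈ P, β - cr i β • Δ i ∈ P)
    (c : Fin r → ℝ) (hc : ∀ i, i ∉ S → c i = 0)
    (hz : ∀ β ∈ P, (∑ i, c i • cr i) β = 0) : c = 0 := by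
  have hv : ∑ i, (c i * ((∑ β ∈ P, cr i β ^ 2) / 2)) • Δ i = 0 := by
    rw [← Module.forall_dual_apply_eq_zero_iff ℝ]
    intro h
    have e := pw_form P S Δ cr h2 hP c hc h
    rw [Finset.sum_eq_zero (fun β hβ => by rw [hz β hβ, mul_zero])] at e
    simp only [map_sum, map_smul, smul_eq_mul]
    exact e.symm
  have := Fintype.linearIndependent_iff.1 hind _ hv
  funext i
  by_cases hi : i ∈ S
  · have hp := pw_norm_pos P S Δ cr h2 hΔP i hi
    rcases mul_eq_zero.1 (this i) with h | h
    · exact h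
    · linarith
  · exact hc i hi

lemma pw_unique {r : ℕ} (P : Finset V) (S : Set (Fin r)) (Δ : Fin r → V)
    (hind : LinearIndependent ℝ Δ)
    (cr : Fin r → Module.Dual ℝ V) (h2 : ∀ i, cr i (Δ i) = 2)
    (hΔP : ∀ i ∈ S, Δ i ∈ P)
    (hP : ∀ i ∈ S, ∀ β ∈ P, β - cr i β • Δ i ∈ P) (n : ℕ) :
    ∀ (c : Fin r → ℤ), (∀ i, i ∉ S → c i = 0) → (∑ i, (c i).natAbs = n) →
    (∀ β ∈ P, (∑ i, (c i : ℝ) • cr i) β = 0 ∨ (∑ i, (c i : ℝ) • cr i) β = 1 ∨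
      (∑ i, (c i : ℝ) • cr i) β = -1) → c = 0 := by
  classical
  induction n using Nat.strong_induction_on with
  | _ n ih =>
  intro c hc hn hval
  by_contra hne
  set d := ∑ i, (c i : ℝ) • cr i with hd
  have hcR : ∀ i, i ∉ S → (c i : ℝ) = 0 := fun i hi => by rw [hc i hi]; simp
  have e := pw_form P S Δ cr h2 hP (fun i => (c i : ℝ)) hcR d
  rw [← hd] at e
  have hpos : 0 < ∑ β ∈ P, d β * d β := by
    by_contra hle
    have h0 : ∑ β ∈ P, d β * d β = 0 :=
      le_antisymm (not_lt.1 hle) (Finset.sum_nonneg fun β _ => mul_self_nonneg _)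
    have := (Finset.sum_eq_zero_iff_of_nonneg (fun β _ => mul_self_nonneg _)).1 h0
    have hz := pw_zero P S Δ hind cr h2 hΔP hP (fun i => (c i : ℝ)) hcR
      (fun β hβ => mul_self_eq_zero.1 (this β hβ))
    apply hne
    funext i
    have := congrFun hz i
    simpa using this
  rw [e] at hpos
  obtain ⟨i, -, hi⟩ := Finset.exists_lt_of_sum_lt (s := Finset.univ) (f := fun _ : Fin r => (0:ℝ))
    (by simpa using hpos)
  have hiS : i ∈ S := by
    by_contra h
    simp [hc i h] at hi
  have hp := pw_norm_pos P S Δ cr h2 hΔP i hiS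
  have hcd : 0 < (c i : ℝ) * d (Δ i) := by
    by_contra h
    nlinarith
  obtain ⟨e, he, hed⟩ : ∃ e : ℤ, (e = 1 ∨ e = -1) ∧ d (Δ i) = e := by
    rcases hval _ (hΔP i hiS) with h | h | h
    · rw [h] at hcd; simp at hcd
    · exact ⟨1, Or.inl rfl, by simp [h]⟩
    · exact ⟨-1, Or.inr rfl, by simp [h]⟩
  have hce : 0 < c i * e := by rw [hed] at hcd; exact_mod_cast hcd
  set c' : Fin r → ℤ := c - Pi.single i e with hc'
  have hd' : ∑ j, (c' j : ℝ) • cr j = d - (e : ℝ) • cr i := by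
    exact pw_sum_single c i e cr
  have hz : c' = 0 := by
    refine ih (∑ j, (c' j).natAbs) ?_ c' ?_ rfl ?_
    · rw [← hn]
      refine Finset.sum_lt_sum ?_ ⟨i, Finset.mem_univ _, ?_⟩
      · intro j _
        by_cases hj : j = i
        · subst hj
          simp only [hc', Pi.sub_apply, Pi.single_eq_same]
          rcases he with rfl | rfl <;> omega
        · simp [hc', hj]
      · simp only [hc', Pi.sub_apply, Pi.single_eq_same]
        rcases he with rfl | rfl <;> omega
    · intro j hj
      have : j ≠ i := fun h => hj (h ▸ hiS)
      simp [hc', this, hc j hj]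
    · intro β hβ
      have := hval _ (hP i hiS β hβ)
      have e2 : (∑ j, (c' j : ℝ) • cr j) β = d (β - cr i β • Δ i) := by
        rw [hd']
        simp [hed]; ring
      rw [e2]; exact this
  have : d - (e : ℝ) • cr i = 0 := by rw [← hd', hz]; simp
  have := congrArg (fun f => f (Δ i)) this
  simp [h2, hed] at this
  rcases he with rfl | rfl <;> norm_num at this

/-- positive element has a simple coroot with positive pairing -/
lemma pw_exists_pos {r : ℕ} (P : Finset V) (S : Set (Fin r)) (Δ : Fin r → V)
    (cr : Fin r → Module.Dual ℝ V) (h2 : ∀ i, cr i (Δ i) = 2)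
    (hΔP : ∀ i ∈ S, Δ i ∈ P)
    (hP : ∀ i ∈ S, ∀ β ∈ P, β - cr i β • Δ i ∈ P)
    (c : Fin r → ℕ) (hc : ∀ i, i ∉ S → c i = 0) (β : V) (hβ : β = ∑ i, (c i : ℝ) • Δ i)
    (hβ0 : β ≠ 0) : ∃ i ∈ S, 0 < cr i β := by
  set N : Fin r → ℝ := fun i => ∑ β ∈ P, cr i β ^ 2 with hN
  set y : Module.Dual ℝ V := ∑ i, (2 * c i / N i) • cr i with hy
  have hB : ∀ h : Module.Dual ℝ V, ∑ γ ∈ P, h γ * y γ = h β := by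
    intro h
    rw [hy, pw_form P S Δ cr h2 hP _ (fun i hi => by simp [hc i hi]) h, hβ]
    simp only [map_sum, map_smul, smul_eq_mul]
    refine Finset.sum_congr rfl fun i _ => ?_
    by_cases hi : i ∈ S
    · have hp : 0 < N i := pw_norm_pos P S Δ cr h2 hΔP i hi
      change 2 * (c i : ℝ) / N i * (N i / 2) * _ = _
      field_simp
    · simp [hc i hi]
  have hyp : 0 < y β := by
    rw [← hB y]
    by_contra hle
    have h0 : ∑ β ∈ P, y β * y β = 0 :=
      le_antisymm (not_lt.1 hle) (Finset.sum_nonneg fun β _ => mul_self_nonneg _)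
    have := (Finset.sum_eq_zero_iff_of_nonneg (fun β _ => mul_self_nonneg _)).1 h0
    apply hβ0
    rw [← Module.forall_dual_apply_eq_zero_iff ℝ]
    intro h
    rw [← hB h]
    exact Finset.sum_eq_zero fun γ hγ => by rw [mul_self_eq_zero.1 (this γ hγ), mul_zero]
  rw [hy, LinearMap.sum_apply] at hyp
  obtain ⟨i, -, hi⟩ := Finset.exists_lt_of_sum_lt (s := Finset.univ) (f := fun _ : Fin r => (0:ℝ))
    (by simpa using hyp)
  have hiS : i ∈ S := by
    by_contra h
    simp [hc i h] at hi
  have hp : 0 < N i := pw_norm_pos P S Δ cr h2 hΔP i hiS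
  refine ⟨i, hiS, ?_⟩
  by_contra h
  have h1 : 0 ≤ 2 * (c i : ℝ) / N i := by positivity
  have hi' : 0 < 2 * (c i : ℝ) / N i * cr i β := hi
  nlinarith

end


/-- Peterson–Woodward lemma: Let `Φ` be a reduced crystallographic root
system in a finite-dimensional real vector space `V`, with coroot map `coroot` into the
dual space, let `Δ = (Δ i)_{i : Fin r}` be a base (system of simple roots) of `Φ`, and
let `S` be a subset of the simple roots. Let `Q^∨` be the ℤ-span (additive subgroup
closure) of all coroots and `Q^∨_S` the ℤ-span of the coroots of the simple roots in
`S`, and let `Φ_S⁺` be the positive roots lying in the ℤ-span of the simple roots in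
`S`. Then every coset of `Q^∨_S` in `Q^∨` contains a unique element `h` with
`⟨α, h⟩ ∈ {0, -1}` for all `α ∈ Φ_S⁺`. -/
theorem peterson_woodward_lifting
    {V : Type*} [AddCommGroup V] [Module ℝ V] [FiniteDimensional ℝ V]
    (Φ : Set V) (hfin : Φ.Finite) (hzero : (0 : V) ∉ Φ)
    (hspan : Submodule.span ℝ Φ = ⊤)
    (coroot : V → Module.Dual ℝ V)
    (hpairing : ∀ α ∈ Φ, coroot α α = 2)
    (hcrys : ∀ α ∈ Φ, ∀ β ∈ Φ, ∃ n : ℤ, coroot α β = (n : ℝ))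
    (hrefl : ∀ α ∈ Φ, ∀ β ∈ Φ, β - coroot α β • α ∈ Φ)
    (hreduced : ∀ α ∈ Φ, ∀ t : ℝ, t • α ∈ Φ → t = 1 ∨ t = -1)
    -- `Δ` is a base of `Φ`:
    (r : ℕ) (Δ : Fin r → V) (hΔmem : ∀ i, Δ i ∈ Φ)
    (hΔindep : LinearIndependent ℝ Δ)
    (hΔspan : Submodule.span ℝ (Set.range Δ) = ⊤)
    (hΔbase : ∀ α ∈ Φ,
      (∃ c : Fin r → ℕ, α = ∑ i, (c i : ℝ) • Δ i) ∨
      (∃ c : Fin r → ℕ, α = -∑ i, (c i : ℝ) • Δ i))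
    (S : Set (Fin r)) :
    ∀ q ∈ AddSubgroup.closure (coroot '' Φ),
      ∃! h : Module.Dual ℝ V,
        h ∈ AddSubgroup.closure (coroot '' Φ) ∧
        h - q ∈ AddSubgroup.closure ((fun i => coroot (Δ i)) '' S) ∧
        ∀ α ∈ Φ, (∃ c : Fin r → ℕ, α = ∑ i, (c i : ℝ) • Δ i) →
          α ∈ AddSubgroup.closure (Δ '' S) →
          (h α = 0 ∨ h α = -1) := by
  classical
  set cr : Fin r → Module.Dual ℝ V := fun i => coroot (Δ i) with hcr
  have h2 : ∀ i, cr i (Δ i) = 2 := fun i => hpairing _ (hΔmem i)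
  set P : Finset V := (hfin.subset (Set.inter_subset_left (s := Φ)
    (t := {β | β ∈ AddSubgroup.closure (Δ '' S)}))).toFinset with hPdef
  have memP : ∀ β, β ∈ P ↔ β ∈ Φ ∧ β ∈ AddSubgroup.closure (Δ '' S) := by
    intro β; simp [hPdef]
  have hΔP : ∀ i ∈ S, Δ i ∈ P := fun i hi =>
    (memP _).2 ⟨hΔmem i, AddSubgroup.subset_closure ⟨i, hi, rfl⟩⟩
  have hP : ∀ i ∈ S, ∀ β ∈ P, β - cr i β • Δ i ∈ P := by
    intro i hi β hβ
    rw [memP] at hβ ⊢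
    refine ⟨hrefl _ (hΔmem i) _ hβ.1, ?_⟩
    obtain ⟨n, hn⟩ := hcrys _ (hΔmem i) _ hβ.1
    have : cr i β • Δ i = n • Δ i := by
      rw [show cr i β = (n : ℝ) from hn, Int.cast_smul_eq_zsmul]
    rw [this]
    exact AddSubgroup.sub_mem _ hβ.2
      (AddSubgroup.zsmul_mem _ (AddSubgroup.subset_closure (Set.mem_image_of_mem Δ hi)) _)
  -- coefficients
  have huniq : ∀ a b : Fin r → ℝ, ∑ i, a i • Δ i = ∑ i, b i • Δ i → a = b := by
    intro a b hab
    have : ∑ i, (a i - b i) • Δ i = 0 := by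
      simp only [sub_smul, Finset.sum_sub_distrib, hab, sub_self]
    funext i
    exact sub_eq_zero.1 (Fintype.linearIndependent_iff.1 hΔindep _ this i)
  have hsupp : ∀ c : Fin r → ℕ, (∑ i, (c i : ℝ) • Δ i) ∈ AddSubgroup.closure (Δ '' S) →
      ∀ i, i ∉ S → c i = 0 := by
    intro c hc i hi
    obtain ⟨e, he, hce⟩ := (pw_closure _ _ _).1 hc
    have : (fun i => (c i : ℝ)) = fun i => (e i : ℝ) := by
      apply huniq
      rw [hce]
      exact Finset.sum_congr rfl fun i _ => by rw [Int.cast_smul_eq_zsmul]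
    have := congrFun this i
    simp only [he i hi] at this
    exact_mod_cast this
  have hsgn : ∀ β ∈ P, (∃ c : Fin r → ℕ, β = ∑ i, (c i : ℝ) • Δ i) ∨
      (-β ∈ P ∧ ∃ c : Fin r → ℕ, -β = ∑ i, (c i : ℝ) • Δ i) := by
    intro β hβ
    have hβ' := (memP _).1 hβ
    rcases hΔbase β hβ'.1 with h | ⟨c, hc⟩
    · exact Or.inl h
    · refine Or.inr ⟨(memP _).2 ⟨?_, AddSubgroup.neg_mem _ hβ'.2⟩, c, by rw [hc, neg_neg]⟩
      have := hrefl β hβ'.1 β hβ'.1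
      rw [hpairing β hβ'.1] at this
      convert this using 1
      module
  have hclo : ∀ x : Module.Dual ℝ V, x ∈ AddSubgroup.closure ((fun i => coroot (Δ i)) '' S) ↔
      ∃ c : Fin r → ℤ, (∀ i, i ∉ S → c i = 0) ∧ x = ∑ i, (c i : ℝ) • cr i := by
    intro x
    rw [pw_closure]
    refine exists_congr fun c => and_congr_right fun _ => ?_
    rw [Finset.sum_congr rfl (fun i _ => (pw_cast (c i) (cr i)).symm)]
  intro q hq
  have hsub : ∀ x ∈ AddSubgroup.closure ((fun i => coroot (Δ i)) '' S),
      x ∈ AddSubgroup.closure (coroot '' Φ) := by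
    intro x hx
    refine AddSubgroup.closure_mono ?_ hx
    rintro _ ⟨i, -, rfl⟩
    exact ⟨Δ i, hΔmem i, rfl⟩
  have hint : ∀ x ∈ AddSubgroup.closure (coroot '' Φ), ∀ β ∈ Φ, ∃ n : ℤ, x β = n := by
    intro x hx β hβ
    induction hx using AddSubgroup.closure_induction with
    | mem x hx => obtain ⟨α, hα, rfl⟩ := hx; exact hcrys α hα β hβ
    | zero => exact ⟨0, by simp⟩
    | add x y _ _ hx hy =>
      obtain ⟨a, ha⟩ := hx
      obtain ⟨b, hb⟩ := hy
      exact ⟨a + b, by simp [ha, hb]⟩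
    | neg x _ hx =>
      obtain ⟨a, ha⟩ := hx
      exact ⟨-a, by simp [ha]⟩
  set T := AddSubgroup.closure ((fun i => coroot (Δ i)) '' S) with hT
  have hcrT : ∀ i ∈ S, cr i ∈ T := fun i hi => AddSubgroup.subset_closure ⟨i, hi, rfl⟩
  apply existsUnique_of_exists_of_unique
  · -- existence
    have hintc : ∀ h : Module.Dual ℝ V, h - q ∈ T → ∀ β ∈ P, ∃ n : ℤ, h β = n := by
      intro h hh β hβ
      refine hint h ?_ β ((memP _).1 hβ).1
      have := AddSubgroup.add_mem _ (hsub _ hh) hq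
      simpa using this
    have hnat : ∀ h : {h : Module.Dual ℝ V // h - q ∈ T}, ∃ n : ℕ,
        ∑ β ∈ P, h.1 β * h.1 β = n := by
      rintro ⟨h, hh⟩
      choose! z hz using hintc h hh
      refine ⟨∑ β ∈ P, (z β * z β).natAbs, ?_⟩
      push_cast
      refine Finset.sum_congr rfl fun β hβ => ?_
      rw [hz β hβ]
      rw [Nat.cast_natAbs, abs_of_nonneg (mul_self_nonneg _)]
      push_cast; rfl
    choose m hm using hnat
    have hne : Nonempty {h : Module.Dual ℝ V // h - q ∈ T} := ⟨⟨q, by simp⟩⟩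
    obtain ⟨h0, hh0⟩ : ∃ h0, ∀ h, m h0 ≤ m h := by
      obtain ⟨h0, -, hh⟩ := (measure m).wf.has_min Set.univ Set.univ_nonempty
      exact ⟨h0, fun h => not_lt.1 (hh h (Set.mem_univ _))⟩
    set N : Module.Dual ℝ V → ℝ := fun h => ∑ β ∈ P, h β * h β with hN
    let Mn : Set (Module.Dual ℝ V) := {h | h - q ∈ T ∧ ∀ h', h' - q ∈ T → N h ≤ N h'}
    have h0M : h0.1 ∈ Mn := by
      refine ⟨h0.2, fun h' hh' => ?_⟩
      have := hh0 ⟨h', hh'⟩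
      have a := hm h0
      have b := hm ⟨h', hh'⟩
      simp only [hN]
      rw [a, b]; exact_mod_cast this
    have hshift : ∀ i ∈ S, ∀ h : Module.Dual ℝ V, ∀ k : ℝ, N (h + k • cr i)
        = N h + (k * h (Δ i) + k ^ 2) * ∑ β ∈ P, cr i β ^ 2 := by
      intro i hi h k
      have key := pw_key P (cr i) (Δ i) (h2 i) (hP i hi) h
      have : N (h + k • cr i) = N h + k * (2 * ∑ β ∈ P, h β * cr i β)
          + k ^ 2 * ∑ β ∈ P, cr i β ^ 2 := by
        simp only [hN, Finset.mul_sum, ← Finset.sum_add_distrib]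
        refine Finset.sum_congr rfl fun β _ => ?_
        simp; ring
      rw [this, key]; ring
    have hsimple : ∀ h ∈ Mn, ∀ i ∈ S, |h (Δ i)| ≤ 1 := by
      intro h hh i hi
      have hp := pw_norm_pos P S Δ cr h2 hΔP i hi
      have a := hh.2 (h + (1 : ℝ) • cr i) (by
        have := AddSubgroup.add_mem _ hh.1 (hcrT i hi)
        convert this using 1; module)
      have b := hh.2 (h + (-1 : ℝ) • cr i) (by
        have := AddSubgroup.sub_mem _ hh.1 (hcrT i hi)
        convert this using 1; module)
      rw [hshift i hi] at a b
      rw [abs_le]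
      constructor <;> by_contra hcon <;> nlinarith
    have hMrefl : ∀ h ∈ Mn, ∀ i ∈ S, h - h (Δ i) • cr i ∈ Mn := by
      intro h hh i hi
      refine ⟨?_, ?_⟩
      · obtain ⟨n, hn⟩ := hintc h hh.1 _ (hΔP i hi)
        have := AddSubgroup.sub_mem _ hh.1 (AddSubgroup.zsmul_mem _ (hcrT i hi) n)
        have e : h - (n : ℝ) • cr i - q = h - q - n • cr i := by
          rw [← pw_cast n (cr i)]; abel
        rw [hn, e]; exact this
      · have : N (h - h (Δ i) • cr i) = N h := by
          have e : h - h (Δ i) • cr i = h + (-h (Δ i)) • cr i := by module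
          rw [e, hshift i hi]; ring
        rw [this]; exact hh.2
    have hall : ∀ n : ℕ, ∀ c : Fin r → ℕ, ∑ i, c i = n → ∀ β ∈ P, β = ∑ i, (c i : ℝ) • Δ i →
        ∀ h ∈ Mn, |h β| ≤ 1 := by
      intro n
      induction n using Nat.strong_induction_on with
      | _ n ih =>
      intro c hcn β hβ hβc h hh
      have hβ' := (memP _).1 hβ
      have hcS := hsupp c (hβc ▸ hβ'.2)
      have hβ0 : β ≠ 0 := fun h => hzero (h ▸ hβ'.1)
      obtain ⟨i, hi, hip⟩ := pw_exists_pos P S Δ cr h2 hΔP hP c hcS β hβc hβ0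
      by_cases hβi : β = Δ i
      · rw [hβi]; exact hsimple h hh i hi
      obtain ⟨k, hk⟩ := hcrys _ (hΔmem i) _ hβ'.1
      have hk' : cr i β = k := hk
      have hkpos : 0 < k := by rw [hk'] at hip; exact_mod_cast hip
      have hγP := hP i hi β hβ
      set γ := β - cr i β • Δ i with hγ
      have hγc : γ = ∑ j, ((c j : ℝ) - (Pi.single i (k:ℝ) : Fin r → ℝ) j) • Δ j := by
        simp only [sub_smul, Finset.sum_sub_distrib, ← hβc, hγ, hk']
        congr 1
        rw [Finset.sum_eq_single i]
        · simp
        · intro j _ hj; simp [hj]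
        · simp
      obtain ⟨j, hji, hj⟩ : ∃ j, j ≠ i ∧ c j ≠ 0 := by
        by_contra hcon
        push Not at hcon
        have e : β = (c i : ℝ) • Δ i := by
          rw [hβc, Finset.sum_eq_single i]
          · intro j _ hj; simp [hcon j hj]
          · simp
        rcases hreduced _ (hΔmem i) (c i) (e ▸ hβ'.1) with h1 | h1
        · rw [h1, one_smul] at e; exact hβi e
        · have : (0:ℝ) ≤ c i := Nat.cast_nonneg _
          linarith
      rcases hΔbase γ ((memP _).1 hγP).1 with ⟨e, he⟩ | ⟨e, he⟩
      · have hce := huniq _ _ (hγc.symm.trans he)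
        have hlt : ∑ l, e l < n := by
          have : (∑ l, (e l : ℝ)) = (n : ℝ) - k := by
            rw [← Finset.sum_congr rfl (fun l _ => congrFun hce l), Finset.sum_sub_distrib]
            rw [← hcn]
            simp
          have h3 : (0:ℝ) < k := by exact_mod_cast hkpos
          have : (∑ l, (e l : ℝ)) < n := by linarith
          exact_mod_cast this
        have := ih _ hlt e rfl γ hγP he _ (hMrefl h hh i hi)
        have e3 : (h - h (Δ i) • cr i) γ = h β := by
          rw [hγ]; simp [h2]; ring
        rwa [e3] at this
      · exfalso
        have : γ = ∑ l, (-(e l : ℝ)) • Δ l := by rw [he]; simp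
        have hce := congrFun (huniq _ _ (hγc.symm.trans this)) j
        simp only [Pi.single_eq_of_ne hji] at hce
        have h3 : (0:ℝ) < c j := by exact_mod_cast Nat.pos_of_ne_zero hj
        have h4 : (0:ℝ) ≤ e j := Nat.cast_nonneg _
        linarith
    let A : Set (Fin r → ℤ) := {c | (∀ i, i ∉ S → c i = 0) ∧ q + ∑ i, (c i : ℝ) • cr i ∈ Mn}
    have hAne : A.Nonempty := by
      obtain ⟨c, hc, hcq⟩ := (hclo _).1 h0.2
      refine ⟨c, hc, ?_⟩
      rw [← hcq]; simpa using h0M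
    have hAfin : A.Finite := by
      have hex : ∀ c ∈ A, ∀ i ∈ S, ∃ n : ℤ, (q + ∑ i, (c i : ℝ) • cr i) (Δ i) = n :=
        fun c hc i hi => hintc _ hc.2.1 _ (hΔP i hi)
      choose! z hz using hex
      have hfinT : (Set.pi Set.univ (fun _ : Fin r => (Set.Icc (-1) 1 : Set ℤ))).Finite :=
        Set.Finite.pi' (fun _ => Set.finite_Icc _ _) |>.subset (by intro x hx i; exact hx i trivial)
      refine Set.Finite.of_finite_image (f := fun c i => if i ∈ S then z c i else 0)
        (hfinT.subset ?_) ?_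
      · rintro _ ⟨c, hc, rfl⟩ i -
        by_cases hi : i ∈ S
        · have := hsimple _ hc.2 i hi
          rw [hz c hc i hi, abs_le] at this
          simp only [hi, if_true, Set.mem_Icc]
          exact_mod_cast this
        · simp [hi]
      · intro c hc c' hc' hcc
        have hd : ∀ i ∈ S, (∑ j, ((c j : ℝ) - c' j) • cr j) (Δ i) = 0 := by
          intro i hi
          have := congrFun hcc i
          simp only [hi, if_true] at this
          have a := hz c hc i hi
          have b := hz c' hc' i hi
          rw [← this] at b
          have e := pw_sum_sub (fun j => (c j : ℝ)) (fun j => (c' j : ℝ)) cr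
          rw [e, LinearMap.sub_apply]
          rw [LinearMap.add_apply] at a b
          linarith
        have := pw_zero P S Δ hΔindep cr h2 hΔP hP (fun j => (c j : ℝ) - c' j)
          (fun i hi => by simp [hc.1 i hi, hc'.1 i hi]) (by
            intro β hβ
            obtain ⟨e, he, hβe⟩ := (pw_closure _ _ _).1 ((memP _).1 hβ).2
            rw [hβe, map_sum]
            refine Finset.sum_eq_zero fun i _ => ?_
            by_cases hi : i ∈ S
            · rw [map_zsmul, hd i hi, smul_zero]
            · rw [he i hi]; simp)
        funext i
        have := congrFun this i
        simp only [Pi.zero_apply, sub_eq_zero] at this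
        exact_mod_cast this
    obtain ⟨c, hcA, hcmin⟩ := Set.exists_min_image A (fun c => ∑ i, c i) hAfin hAne
    set h := q + ∑ i, (c i : ℝ) • cr i with hh
    have hneg : ∀ i ∈ S, h (Δ i) ≤ 0 := by
      intro i hi
      by_contra hcon
      push Not at hcon
      obtain ⟨n, hn⟩ := hintc h hcA.2.1 _ (hΔP i hi)
      have h1 := hsimple h hcA.2 i hi
      have hn1 : n = 1 := by
        rw [hn] at hcon h1
        rw [abs_le] at h1
        have a : 0 < n := by exact_mod_cast hcon
        have b : n ≤ 1 := by exact_mod_cast h1.2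
        omega
      have hR := hMrefl h hcA.2 i hi
      rw [hn, hn1] at hR
      have hmem : c - Pi.single i 1 ∈ A := by
        refine ⟨?_, ?_⟩
        · intro j hj
          have : j ≠ i := fun h => hj (h ▸ hi)
          simp [this, hcA.1 j hj]
        · convert hR using 1
          have e := pw_sum_single c i 1 cr
          rw [e, hh]
          abel
      have := hcmin _ hmem
      simp [Finset.sum_sub_distrib] at this
    refine ⟨h, ?_, hcA.2.1, ?_⟩
    · have := AddSubgroup.add_mem _ (hsub _ hcA.2.1) hq
      rwa [sub_add_cancel] at this
    · rintro β hβ ⟨e, he⟩ hβS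
      have hβP : β ∈ P := (memP _).2 ⟨hβ, hβS⟩
      have habs := hall _ e rfl β hβP he h hcA.2
      have hle : h β ≤ 0 := by
        rw [he, map_sum]
        refine Finset.sum_nonpos fun i _ => ?_
        rw [map_smul, smul_eq_mul]
        by_cases hi : i ∈ S
        · exact mul_nonpos_of_nonneg_of_nonpos (Nat.cast_nonneg _) (hneg i hi)
        · rw [hsupp e (he ▸ hβS) i hi]; simp
      obtain ⟨n, hn⟩ := hintc h hcA.2.1 _ hβP
      rw [hn] at hle habs ⊢
      rw [abs_le] at habs
      have a : n ≤ 0 := by exact_mod_cast hle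
      have b : -1 ≤ n := by exact_mod_cast habs.1
      have : n = 0 ∨ n = -1 := by omega
      rcases this with rfl | rfl <;> simp
  · -- uniqueness
    rintro h h' ⟨-, hT1, hv⟩ ⟨-, hT2, hv'⟩
    have hd : h - h' ∈ T := by
      have := AddSubgroup.sub_mem _ hT1 hT2
      simpa using this
    obtain ⟨c, hc, hcd⟩ := (hclo _).1 hd
    have hpos : ∀ β ∈ P, (∃ c : Fin r → ℕ, β = ∑ i, (c i : ℝ) • Δ i) →
        (h - h') β = 0 ∨ (h - h') β = 1 ∨ (h - h') β = -1 := by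
      intro β hβ hβc
      have hβ' := (memP _).1 hβ
      rw [LinearMap.sub_apply]
      rcases hv β hβ'.1 hβc hβ'.2 with a | a <;> rcases hv' β hβ'.1 hβc hβ'.2 with b | b <;>
        rw [a, b] <;> norm_num
    have : c = 0 := by
      refine pw_unique P S Δ hΔindep cr h2 hΔP hP _ c hc rfl ?_
      rw [← hcd]
      intro β hβ
      rcases hsgn β hβ with hβc | ⟨hβn, hβc⟩
      · exact hpos β hβ hβc
      · have := hpos _ hβn hβc
        rw [map_neg] at this
        rcases this with h | h | h
        · left; linarith
        · right; right; linarith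
        · right; left; linarith
    rw [this] at hcd
    simpa [sub_eq_zero] using hcd
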